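/- arXiv:1206.3591 — 2 statements merged into one kernel-verified Lean document; each statement's English description precedes it below -/
import Mathlib

section
/- The Bell number of the cycle C_n equals the number of partitions of an n-element set into non-empty blocks each of size at least 2, for all n ≥ 3. -/
open Finset SimpleGraph Polynomial

/-- Stirling numbers of the second kind. -/
def stirling2 : ℕ → ℕ → ℕ
  | 0, 0 => 1
  | 0, _ + 1 => 0
  | _ + 1, 0 => 0
  | n + 1, k + 1 => (k + 1) * stirling2 n (k + 1) + stirling2 n k

/-- Bell numbers. -/
def bell (n : ℕ) : ℕ := ∑ k ∈ Finset.range (n + 1), stirling2 n k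

/-- `graphStirling G k` is the number of partitions of the vertex set of `G`
into exactly `k` non-empty independent sets. -/
noncomputable def graphStirling {V : Type} [Fintype V] [DecidableEq V] (G : SimpleGraph V) (k : ℕ) : ℕ :=
  Nat.card {P : Finpartition (Finset.univ : Finset V) //
    P.parts.card = k ∧ ∀ p ∈ P.parts, ∀ u ∈ p, ∀ v ∈ p, ¬ G.Adj u v}

/-- The number of proper colorings of `G` with `x` colors
(the chromatic polynomial evaluated at `x`). -/
noncomputable def chromaticCount {V : Type} [Fintype V] (G : SimpleGraph V) (x : ℕ) : ℕ :=
  Nat.card {f : V → Fin x // ∀ u v, G.Adj u v → f u ≠ f v}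

section helpers
open Classical

lemma ie_aux {α ι : Type} [Finite α] [Fintype ι] (A : ι → α → Prop) :
    (Nat.card {x // ∀ i, ¬ A i x} : ℤ) =
      ∑ t ∈ (Finset.univ : Finset ι).powerset,
        (-1 : ℤ) ^ t.card * (Nat.card {x // ∀ i ∈ t, A i x} : ℤ) := by
  have := Fintype.ofFinite α
  have h := Finset.inclusion_exclusion_card_inf_compl (Finset.univ : Finset ι)
    (fun i => (Finset.univ.filter (A i) : Finset α))
  have key : ∀ (p : α → Prop) (s : Finset α), (∀ x, x ∈ s ↔ p x) →
      Nat.card {x // p x} = s.card := by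
    intro p s hs
    rw [Nat.card_eq_fintype_card]
    exact Fintype.card_of_subtype s hs
  rw [key _ _ (fun x => ?_), h]
  · refine Finset.sum_congr rfl fun t _ => ?_
    rw [key _ (t.inf fun i => (Finset.univ.filter (A i) : Finset α)) (fun x => ?_)]
    simp [Finset.mem_inf]
  · simp [Finset.mem_inf]

lemma ie_eq {α ι : Type} [Finite α] [Fintype ι] (A B : ι → α → Prop)
    (h : ∀ t : Finset ι, Nat.card {x // ∀ i ∈ t, A i x} = Nat.card {x // ∀ i ∈ t, B i x}) :
    Nat.card {x // ∀ i, ¬ A i x} = Nat.card {x // ∀ i, ¬ B i x} := by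
  have h1 := ie_aux A
  have h2 := ie_aux B
  simp only [h] at h1
  exact_mod_cast h1.trans h2.symm

open Fin.CommRing in
lemma iter_add_aux (m : ℕ) (k : ℕ) (i : Fin (m+2)) :
    (fun x : Fin (m+2) => x + 1)^[k] i = i + (k : Fin (m+2)) := by
  induction k with
  | zero => simp
  | succ k ih => rw [Function.iterate_succ_apply', ih]; push_cast; ring

open Fin.CommRing in
lemma iter_add (m : ℕ) (k : Fin (m+2)) (i : Fin (m+2)) :
    (fun x : Fin (m+2) => x + 1)^[k.val] i = i + k := by
  rw [iter_add_aux, Fin.cast_val_eq_self]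

lemma rel_iter {m : ℕ} (r : Setoid (Fin (m+2))) (i : Fin (m+2)) (k : ℕ)
    (h : ∀ j < k, r ((fun x : Fin (m+2) => x + 1)^[j] i)
      ((fun x : Fin (m+2) => x + 1)^[j] i + 1)) :
    r i ((fun x : Fin (m+2) => x + 1)^[k] i) := by
  induction k with
  | zero => exact r.refl _
  | succ k ih =>
    rw [Function.iterate_succ_apply']
    exact r.trans (ih fun j hj => h j (by omega)) (h k (by omega))

lemma exists_rho {m : ℕ} (t : Finset (Fin (m+2))) (ht : t ≠ Finset.univ) :
    ∃ ρ : Fin (m+2) → Fin (m+2), (∀ i, ρ i ∉ t) ∧ (∀ i, i ∉ t → ρ i = i) ∧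
      (∀ i ∈ t, ρ i = ρ (i+1)) ∧
      ∀ r : Setoid (Fin (m+2)), (∀ i ∈ t, r i (i+1)) → ∀ i, r i (ρ i) := by
  obtain ⟨j, hj⟩ : ∃ j, j ∉ t := by
    by_contra! h
    exact ht (Finset.eq_univ_iff_forall.2 h)
  have ex : ∀ i, ∃ k, (fun x : Fin (m+2) => x + 1)^[k] i ∉ t := fun i =>
    ⟨(j - i).val, by rw [iter_add]; simpa using hj⟩
  refine ⟨fun i => (fun x : Fin (m+2) => x + 1)^[Nat.find (ex i)] i,
    fun i => Nat.find_spec (ex i), ?_, ?_, ?_⟩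
  · intro i hi
    have : Nat.find (ex i) = 0 := by rw [Nat.find_eq_zero]; simpa using hi
    simp only [this, Function.iterate_zero, id]
  · intro i hi
    have : Nat.find (ex i) = Nat.find (ex (i+1)) + 1 := by
      rw [Nat.find_eq_iff]
      refine ⟨?_, ?_⟩
      · rw [Function.iterate_succ_apply]; exact Nat.find_spec (ex (i+1))
      · intro n hn
        cases n with
        | zero => simpa using hi
        | succ n =>
          rw [Function.iterate_succ_apply]
          exact Nat.find_min (ex (i+1)) (by omega)
    simp only [this, Function.iterate_succ_apply]
  · intro r hr i
    refine rel_iter r i _ fun k hk => hr _ ?_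
    have := Nat.find_min (ex i) hk
    simpa using this

lemma card_eq {m : ℕ} (t : Finset (Fin (m+2))) :
    Nat.card {r : Setoid (Fin (m+2)) // ∀ i ∈ t, r i (i+1)} =
    Nat.card {r : Setoid (Fin (m+2)) // ∀ i ∈ t, ∀ j, r i j → i = j} := by
  by_cases ht : t = Finset.univ
  · subst ht
    have h1 : Nat.card {r : Setoid (Fin (m+2)) // ∀ i ∈ Finset.univ, r i (i+1)} = 1 := by
      rw [Nat.card_eq_one_iff_unique]
      refine ⟨⟨?_⟩, ⟨⟨⊤, fun i _ => trivial⟩⟩⟩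
      have : ∀ a : {r : Setoid (Fin (m+2)) // ∀ i ∈ Finset.univ, r i (i+1)},
          a.1 = ⊤ := by
        rintro ⟨r, hr⟩
        refine Setoid.eq_top_iff.2 fun i j => ?_
        have := rel_iter r i (j - i).val (fun _ _ => hr _ (Finset.mem_univ _))
        rw [iter_add] at this
        simpa using this
      intro a b
      exact Subtype.ext ((this a).trans (this b).symm)
    have h2 : Nat.card {r : Setoid (Fin (m+2)) //
        ∀ i ∈ Finset.univ, ∀ j, r i j → i = j} = 1 := by
      rw [Nat.card_eq_one_iff_unique]
      refine ⟨⟨?_⟩, ⟨⟨⊥, fun i _ j h => h⟩⟩⟩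
      rintro ⟨r, hr⟩ ⟨s, hs⟩
      refine Subtype.ext (Setoid.ext fun i j => ?_)
      constructor
      · intro h; rw [hr i (Finset.mem_univ _) j h]
      · intro h; rw [hs i (Finset.mem_univ _) j h]
    rw [h1, h2]
  · obtain ⟨ρ, h1, h2, h3, h4⟩ := exists_rho t ht
    refine Nat.card_congr
      { toFun := fun r => ⟨⟨fun a b => a = b ∨ (a ∉ t ∧ b ∉ t ∧ r.1 a b), ?_, ?_, ?_⟩, ?_⟩
        invFun := fun s => ⟨s.1.comap ρ, ?_⟩
        left_inv := ?_
        right_inv := ?_ }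
    · exact fun a => Or.inl rfl
    · rintro a b (h | ⟨ha, hb, h⟩)
      · exact Or.inl h.symm
      · exact Or.inr ⟨hb, ha, r.1.symm h⟩
    · rintro a b c (rfl | ⟨ha, hb, h⟩)
      · exact id
      · rintro (rfl | ⟨hb, hc, h'⟩)
        · exact Or.inr ⟨ha, hb, h⟩
        · exact Or.inr ⟨ha, hc, r.1.trans h h'⟩
    · rintro i hi j (h | ⟨ha, hb, h⟩)
      · exact h
      · exact absurd hi ha
    · intro i hi
      rw [Setoid.comap_rel, h3 i hi]
    · rintro ⟨r, hr⟩
      refine Subtype.ext (Setoid.ext fun a b => ?_)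
      have ha := h4 r hr a
      have hb := h4 r hr b
      change (ρ a = ρ b ∨ (ρ a ∉ t ∧ ρ b ∉ t ∧ r (ρ a) (ρ b))) ↔ r a b
      constructor
      · rintro (h | ⟨_, _, h⟩)
        · rw [h] at ha; exact r.trans ha (r.symm hb)
        · exact r.trans ha (r.trans h (r.symm hb))
      · intro h
        exact Or.inr ⟨h1 a, h1 b, r.trans (r.symm ha) (r.trans h hb)⟩
    · rintro ⟨s, hs⟩
      refine Subtype.ext (Setoid.ext fun a b => ?_)
      change (a = b ∨ (a ∉ t ∧ b ∉ t ∧ s (ρ a) (ρ b))) ↔ s a b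
      constructor
      · rintro (h | ⟨ha, hb, h⟩)
        · rw [h]
        · rwa [h2 a ha, h2 b hb] at h
      · intro h
        by_cases ha : a ∈ t
        · exact Or.inl (hs a ha b h)
        by_cases hb : b ∈ t
        · exact Or.inl (hs b hb a (s.symm h)).symm
        · exact Or.inr ⟨ha, hb, by rwa [h2 a ha, h2 b hb]⟩

noncomputable def fpEquiv (V : Type) [Fintype V] [DecidableEq V] :
    Finpartition (Finset.univ : Finset V) ≃ Setoid V where
  toFun P := Setoid.ker P.part
  invFun r := Finpartition.ofSetoid r
  left_inv P := by
    have key : ∀ a, (Finpartition.ofSetoid (Setoid.ker P.part)).part a = P.part a := by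
      intro a
      ext b
      rw [Finpartition.mem_part_ofSetoid_iff_rel, Setoid.ker_def,
        P.mem_part_iff_part_eq_part (Finset.mem_univ _) (Finset.mem_univ _), eq_comm]
    have hp : ∀ (Q : Finpartition (Finset.univ : Finset V)) p,
        p ∈ Q.parts ↔ ∃ a, Q.part a = p := by
      intro Q p
      constructor
      · intro h
        obtain ⟨a, ha⟩ := Q.nonempty_of_mem_parts h
        exact ⟨a, Q.part_eq_of_mem h ha⟩
      · rintro ⟨a, rfl⟩
        simp
    ext p
    rw [hp, hp]
    simp [key]
  right_inv r := by
    ext a b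
    rw [Setoid.ker_def, ← Finpartition.mem_part_iff_part_eq_part _ (Finset.mem_univ _)
      (Finset.mem_univ _), Finpartition.mem_part_ofSetoid_iff_rel]
    exact ⟨r.symm, r.symm⟩

lemma fpEquiv_rel {V : Type} [Fintype V] [DecidableEq V]
    (P : Finpartition (Finset.univ : Finset V)) (a b : V) :
    fpEquiv V P a b ↔ b ∈ P.part a := by
  change P.part a = P.part b ↔ _
  rw [P.mem_part_iff_part_eq_part (Finset.mem_univ _) (Finset.mem_univ _), eq_comm]

lemma sum_card {V : Type} [Fintype V] [DecidableEq V] (G : SimpleGraph V) :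
    ∑ k ∈ Finset.range (Fintype.card V + 1), graphStirling G k =
    Nat.card {P : Finpartition (Finset.univ : Finset V) //
      ∀ p ∈ P.parts, ∀ u ∈ p, ∀ v ∈ p, ¬ G.Adj u v} := by
  unfold graphStirling
  simp only [Nat.card_eq_fintype_card, Fintype.card_subtype]
  rw [Finset.card_eq_sum_card_fiberwise (f := fun P => P.parts.card)
    (t := Finset.range (Fintype.card V + 1))]
  · refine Finset.sum_congr rfl fun k _ => ?_
    rw [Finset.filter_filter]
    congr 1
    ext P
    simp [and_comm]
  · intro P _
    have := P.card_parts_le_card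
    simp only [Finset.card_univ] at this
    simp only [Finset.coe_range, Set.mem_Iio]
    omega

end helpers

theorem cycle_bell_eq_singleton_free (n : ℕ) (hn : 3 ≤ n) :
    ∑ k ∈ Finset.range (n + 1), graphStirling (SimpleGraph.cycleGraph n) k =
      Nat.card {P : Finpartition (Finset.univ : Finset (Fin n)) //
        ∀ p ∈ P.parts, 2 ≤ p.card} := by
  have h := sum_card (SimpleGraph.cycleGraph n)
  rw [Fintype.card_fin] at h
  rw [h]
  obtain ⟨m, rfl⟩ : ∃ m, n = m + 2 := ⟨n - 2, by omega⟩
  have : Finite (Setoid (Fin (m+2))) := Finite.of_equiv _ (fpEquiv (Fin (m+2)))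
  have key := ie_eq (fun (i : Fin (m+2)) (r : Setoid (Fin (m+2))) => r i (i+1))
    (fun i r => ∀ j, r i j → i = j) card_eq
  refine Eq.trans (Nat.card_congr ((fpEquiv (Fin (m+2))).subtypeEquiv ?_)) (key.trans
    (Nat.card_congr ((fpEquiv (Fin (m+2))).subtypeEquiv ?_)).symm)
  · intro P
    constructor
    · intro h i hi
      rw [fpEquiv_rel] at hi
      refine h (P.part i) (by simp) i (by simp) (i+1) hi ?_
      rw [SimpleGraph.cycleGraph_adj]
      right; exact add_sub_cancel_left i 1
    · intro h p hp u hu v hv huv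
      have hu' := P.part_eq_of_mem hp hu
      have hv' := P.part_eq_of_mem hp hv
      rw [SimpleGraph.cycleGraph_adj, sub_eq_iff_eq_add', sub_eq_iff_eq_add'] at huv
      rcases huv with rfl | rfl
      · exact h v (by rw [fpEquiv_rel, hv']; exact hu)
      · exact h u (by rw [fpEquiv_rel, hu']; exact hv)
  · intro P
    constructor
    · intro h i hi
      have h2 := h (P.part i) (by simp)
      obtain ⟨b, hb, hne⟩ := Finset.exists_mem_ne (by omega : 1 < (P.part i).card) i
      exact hne (hi b ((fpEquiv_rel P i b).2 hb)).symm
    · intro h p hp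
      obtain ⟨a, ha⟩ := P.nonempty_of_mem_parts hp
      have := h a
      push Not at this
      obtain ⟨j, hj, hne⟩ := this
      rw [fpEquiv_rel, P.part_eq_of_mem hp ha] at hj
      exact Finset.one_lt_card.2 ⟨a, ha, j, hj, hne⟩
end

section
/- For every n ≥ 3 and every k with 1 ≤ k ≤ n-1, the graphical Stirling numbers of the cycle C_n satisfy the ultra log-concavity inequality (S(C_n,k)/C(n,k))^2 ≥ (S(C_n,k-1)/C(n,k-1)) · (S(C_n,k+1)/C(n,k+1)), with strict inequality whenever k ≥ χ(C_n). -/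
open Finset SimpleGraph Polynomial

/-- A coloring from an independent partition and an embedding of its parts. -/
def colMap {V : Type} [Fintype V] [DecidableEq V] (G : SimpleGraph V) (x : ℕ)
    (q : Σ P : {P : Finpartition (Finset.univ : Finset V) //
      ∀ p ∈ P.parts, ∀ u ∈ p, ∀ v ∈ p, ¬ G.Adj u v}, (P.1.parts ↪ Fin x)) :
    {f : V → Fin x // ∀ u v, G.Adj u v → f u ≠ f v} :=
  ⟨fun v => q.2 ⟨q.1.1.part v, by simp⟩, by
    intro u v huv h
    have h1 := q.2.injective h
    have h2 : q.1.1.part u = q.1.1.part v := congrArg Subtype.val h1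
    refine q.1.2 (q.1.1.part u) (by simp) u (by simp) v ?_ huv
    rw [h2]; simp⟩

theorem colMap_bij {V : Type} [Fintype V] [DecidableEq V] (G : SimpleGraph V) (x : ℕ) :
    Function.Bijective (colMap G x) := by
  constructor
  · rintro ⟨⟨P, hP⟩, e⟩ ⟨⟨Q, hQ⟩, d⟩ h
    have h' : ∀ v, e ⟨P.part v, by simp⟩ = d ⟨Q.part v, by simp⟩ := by
      intro v
      exact congrFun (congrArg Subtype.val h) v
    have hpart : ∀ v, P.part v = Q.part v := by
      intro v
      ext u
      rw [P.mem_part_iff_part_eq_part (by simp) (by simp),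
        Q.mem_part_iff_part_eq_part (by simp) (by simp)]
      constructor
      · intro huv
        have : e ⟨P.part u, by simp⟩ = e ⟨P.part v, by simp⟩ := by congr 2
        rw [h', h'] at this
        exact congrArg Subtype.val (d.injective this)
      · intro huv
        have : d ⟨Q.part u, by simp⟩ = d ⟨Q.part v, by simp⟩ := by congr 2
        rw [← h', ← h'] at this
        exact congrArg Subtype.val (e.injective this)
    have hPQ : P = Q := by
      ext p
      constructor
      · intro hp
        obtain ⟨v, hv⟩ := P.nonempty_of_mem_parts hp
        rw [← P.part_eq_of_mem hp hv, hpart]; simp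
      · intro hp
        obtain ⟨v, hv⟩ := Q.nonempty_of_mem_parts hp
        rw [← Q.part_eq_of_mem hp hv, ← hpart]; simp
    subst hPQ
    have : e = d := by
      ext ⟨p, hp⟩
      obtain ⟨v, hv⟩ := P.nonempty_of_mem_parts hp
      have := h' v
      simp only [P.part_eq_of_mem hp hv] at this
      rw [this]
    subst this
    rfl
  · rintro ⟨f, hf⟩
    classical
    let P : Finpartition (Finset.univ : Finset V) := Finpartition.ofSetoid (Setoid.ker f)
    have hm : ∀ u v, v ∈ P.part u ↔ f u = f v := by
      intro u v
      exact Finpartition.mem_part_ofSetoid_iff_rel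
    have hP : ∀ p ∈ P.parts, ∀ u ∈ p, ∀ v ∈ p, f u = f v := by
      intro p hp u hu v hv
      rw [← hm, P.part_eq_of_mem hp hu]; exact hv
    choose g hg using fun p : P.parts => P.nonempty_of_mem_parts p.2
    refine ⟨⟨⟨P, fun p hp u hu v hv huv => hf u v huv (hP p hp u hu v hv)⟩,
      ⟨fun p => f (g p), ?_⟩⟩, ?_⟩
    · intro p q hpq
      have := (hm (g p) (g q)).2 hpq
      rw [P.part_eq_of_mem p.2 (hg p)] at this
      exact Subtype.ext (P.eq_of_mem_parts p.2 q.2 this (hg q))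
    · apply Subtype.ext
      funext v
      have h1 := hg ⟨P.part v, by simp⟩
      exact ((hm _ _).1 h1).symm

theorem graphStirling_zero_of_lt {V : Type} [Fintype V] [DecidableEq V] (G : SimpleGraph V) (k : ℕ)
    (h : Fintype.card V < k) : graphStirling G k = 0 := by
  unfold graphStirling
  have : IsEmpty {P : Finpartition (Finset.univ : Finset V) //
    P.parts.card = k ∧ ∀ p ∈ P.parts, ∀ u ∈ p, ∀ v ∈ p, ¬ G.Adj u v} := by
    constructor
    rintro ⟨P, hP, -⟩
    have := P.card_parts_le_card
    rw [Finset.card_univ] at this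
    omega
  exact Nat.card_of_isEmpty

theorem chromaticCount_eq {V : Type} [Fintype V] [DecidableEq V] (G : SimpleGraph V) (x N : ℕ)
    (hN : Fintype.card V < N) :
    chromaticCount G x = ∑ k ∈ Finset.range N, graphStirling G k * x.descFactorial k := by
  classical
  unfold chromaticCount
  rw [← Nat.card_congr (Equiv.ofBijective _ (colMap_bij G x)), Nat.card_eq_fintype_card,
    Fintype.card_sigma]
  simp only [Fintype.card_embedding_eq, Fintype.card_coe, Fintype.card_fin]
  rw [← Finset.sum_fiberwise_of_maps_to (t := Finset.range N) (g := fun P => P.1.parts.card)]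
  · apply Finset.sum_congr rfl
    intro k hk
    rw [Finset.sum_congr rfl (g := fun _ => x.descFactorial k)]
    · rw [Finset.sum_const, smul_eq_mul]
      congr 1
      unfold graphStirling
      rw [← Fintype.card_subtype, ← Nat.card_eq_fintype_card]
      apply Nat.card_congr
      refine (Equiv.subtypeSubtypeEquivSubtypeInter _ (fun P : Finpartition (Finset.univ : Finset V) => P.parts.card = k)).trans ?_
      exact Equiv.subtypeEquivRight (fun P => And.comm)
    · intro P hP
      simp only [Finset.mem_filter] at hP
      rw [hP.2]
  · intro P _
    have := P.1.card_parts_le_card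
    rw [Finset.card_univ] at this
    simp only [Finset.mem_range]; omega

theorem desc_unique (N : ℕ) (c : ℕ → ℤ)
    (h : ∀ x : ℕ, ∑ k ∈ Finset.range N, c k * (x.descFactorial k : ℤ) = 0) :
    ∀ k < N, c k = 0 := by
  intro k
  induction k using Nat.strong_induction_on with
  | _ k ih =>
    intro hk
    have := h k
    rw [Finset.sum_eq_single k] at this
    · rw [Nat.descFactorial_self] at this
      have h2 : ((k.factorial : ℕ) : ℤ) ≠ 0 := by exact_mod_cast k.factorial_ne_zero
      exact (mul_eq_zero.1 this).resolve_right h2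
    · intro b hb hbk
      rcases lt_or_gt_of_ne hbk with h1 | h1
      · rw [ih b h1 (by omega)]; simp
      · rw [Nat.descFactorial_of_lt h1]; simp
    · intro h1; simp at h1; omega

theorem step_card (m x : ℕ) (Q : (Fin (m + 1) → Fin x) → Fin x → Prop) [∀ g c, Decidable (Q g c)]
    (d : ℕ) (p : (Fin (m + 1) → Fin x) → Prop) [DecidablePred p]
    (hQ : ∀ g, p g → (Finset.univ.filter (Q g)).card = d) :
    (Finset.univ.filter (fun f : Fin (m + 2) → Fin x =>
      p (fun i => f i.castSucc) ∧ Q (fun i => f i.castSucc) (f (Fin.last _)))).card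
      = d * (Finset.univ.filter p).card := by
  classical
  rw [← Fintype.card_subtype, mul_comm]
  have e : {f : Fin (m + 2) → Fin x // p (fun i => f i.castSucc) ∧
      Q (fun i => f i.castSucc) (f (Fin.last _))} ≃ Σ g : {g // p g}, {c // Q g.1 c} :=
    { toFun := fun f => ⟨⟨_, f.2.1⟩, ⟨_, f.2.2⟩⟩
      invFun := fun q => ⟨Fin.snoc (α := fun _ => Fin x) q.1.1 q.2.1, by
        simpa using ⟨q.1.2, q.2.2⟩⟩
      left_inv := by
        rintro ⟨f, hf⟩
        apply Subtype.ext
        exact Fin.snoc_init_self f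
      right_inv := by
        rintro ⟨⟨g, hg⟩, ⟨c, hc⟩⟩
        have key : ∀ (g' : Fin (m + 1) → Fin x) (c' : Fin x) (hg' : p g') (hc' : Q g' c'), g' = g → c' = c →
            (⟨⟨g', hg'⟩, ⟨c', hc'⟩⟩ : Σ g : {g // p g}, {c // Q g.1 c}) = ⟨⟨g, hg⟩, ⟨c, hc⟩⟩ := by
          intro g' c' hg' hc' h1 h2
          subst h1 h2
          rfl
        exact key _ _ _ _ (by funext i; simp) (by simp) }
  rw [Fintype.card_congr e, Fintype.card_sigma]
  rw [Finset.sum_congr rfl (g := fun _ => d)]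
  · simp [Fintype.card_subtype]
  · intro g _
    rw [Fintype.card_subtype]; exact hQ g.1 g.2

/-- path colorings -/
def pathOK (m x : ℕ) (f : Fin (m + 1) → Fin x) : Prop := ∀ i : Fin m, f i.castSucc ≠ f i.succ

instance (m x : ℕ) : DecidablePred (pathOK m x) := fun f => by unfold pathOK; infer_instance

theorem pathOK_succ (m x : ℕ) (f : Fin (m + 2) → Fin x) :
    pathOK (m + 1) x f ↔ pathOK m x (fun i => f i.castSucc) ∧
      f (Fin.last m).castSucc ≠ f (Fin.last (m + 1)) := by
  unfold pathOK
  rw [Fin.forall_fin_succ']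
  simp

theorem path_card (m x : ℕ) :
    (((Finset.univ.filter (pathOK m x)).card : ℕ) : ℤ) = x * ((x : ℤ) - 1) ^ m := by
  induction m with
  | zero =>
    rw [Finset.filter_true_of_mem (fun f _ i => i.elim0)]
    simp
  | succ m ih =>
    have := step_card m x (fun g c => g (Fin.last m) ≠ c) (x - 1) (pathOK m x) (by
      intro g _
      rw [Finset.filter_ne, Finset.card_erase_of_mem (by simp)]; simp)
    simp only [pathOK_succ, this]
    rcases x with _ | x
    · simp
    · push_cast at ih ⊢
      rw [ih]; simp; ring

theorem eq_card (m x : ℕ) :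
    (Finset.univ.filter (fun f : Fin (m+2) → Fin x => pathOK (m+1) x f ∧ f 0 = f (Fin.last _))).card =
    (Finset.univ.filter (fun f : Fin (m+1) → Fin x => pathOK m x f ∧ f 0 ≠ f (Fin.last _))).card := by
  have := step_card m x (fun g c => g 0 = c) 1 (fun f => pathOK m x f ∧ f 0 ≠ f (Fin.last _)) (by
      intro g _
      rw [Finset.filter_eq]; simp)
  rw [one_mul] at this
  rw [← this]
  congr 1
  ext f
  rw [Finset.mem_filter, Finset.mem_filter]
  simp only [Finset.mem_univ, true_and, pathOK_succ, Fin.castSucc_zero]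
  constructor
  · rintro ⟨⟨h1, h2⟩, h3⟩
    exact ⟨⟨h1, by rw [h3]; exact h2.symm⟩, h3⟩
  · rintro ⟨⟨h1, h2⟩, h3⟩
    exact ⟨⟨h1, by rw [← h3]; exact h2.symm⟩, h3⟩

theorem ne_card (m x : ℕ) :
    (((Finset.univ.filter (fun f : Fin (m+1) → Fin x => pathOK m x f ∧ f 0 ≠ f (Fin.last _))).card : ℕ) : ℤ)
     = ((x : ℤ) - 1) ^ (m + 1) + (-1) ^ (m + 1) * ((x : ℤ) - 1) := by
  induction m with
  | zero => simp
  | succ m ih =>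
    have h := Finset.card_filter_add_card_filter_not (s := Finset.univ.filter (pathOK (m+1) x))
      (fun f : Fin (m+2) → Fin x => f 0 = f (Fin.last _))
    rw [Finset.filter_filter, Finset.filter_filter, eq_card] at h
    have h2 := path_card (m+1) x
    rw [← h] at h2
    push_cast at h2
    rw [ih] at h2
    have h3 : ∀ a b c : ℤ, a + b = c → b = c - a := by intros; omega
    rw [h3 _ _ _ h2]
    ring

theorem chrom_cycle (m x : ℕ) : (chromaticCount (cycleGraph (m + 2)) x : ℤ) =
    ((x : ℤ) - 1) ^ (m + 2) + (-1) ^ (m + 2) * ((x : ℤ) - 1) := by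
  rw [← ne_card (m + 1) x]
  unfold chromaticCount
  classical
  rw [Nat.card_eq_fintype_card, Fintype.card_subtype]
  congr 2
  ext f
  simp only [Finset.mem_filter, Finset.mem_univ, true_and]
  constructor
  · intro h
    refine ⟨fun i => h _ _ ?_, h _ _ ?_⟩
    · rw [cycleGraph_adj]
      right
      rw [← Fin.coeSucc_eq_succ, add_sub_cancel_left]
    · rw [cycleGraph_adj]
      left
      simp
  · rintro ⟨h1, h2⟩ 
    have key : ∀ u v : Fin (m+2), v - u = 1 → f u ≠ f v := by
      intro u v huv
      have hv : v = u + 1 := by rw [← huv]; simp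
      subst hv
      induction u using Fin.lastCases with
      | last => simpa using h2.symm
      | cast i => have := h1 i; rwa [← Fin.coeSucc_eq_succ] at this
    intro u v huv
    rw [cycleGraph_adj] at huv
    rcases huv with h | h
    · exact (key _ _ h).symm
    · exact key _ _ h

/-- recurrence for the cycle Stirling numbers: `cyc m k` is the value for `C_{m+2}`. -/
def cyc : ℕ → ℕ → ℤ
  | 0, k => if k = 2 then 1 else 0
  | _ + 1, 0 => 0
  | m + 1, k + 1 => k * cyc m (k + 1) + cyc m k + if k = 1 then (-1) ^ (m + 1) else 0

theorem cyc_zero (m : ℕ) : cyc m 0 = 0 := by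
  cases m <;> simp [cyc]

theorem cyc_one (m : ℕ) : cyc m 1 = 0 := by
  cases m <;> simp [cyc, cyc_zero]

theorem cyc_two (m : ℕ) : cyc m 2 = if Even m then 1 else 0 := by
  induction m with
  | zero => simp [cyc]
  | succ m ih =>
    have : cyc (m + 1) 2 = cyc m 2 + (-1) ^ (m + 1) := by simp [cyc, cyc_one]
    rw [this, ih]
    by_cases h : Even m
    · have h2 : Odd (m + 1) := h.add_one
      simp [h, h2.neg_one_pow]
    · have h2 : Even (m + 1) := (Nat.not_even_iff_odd.1 h).add_one
      simp [h, h2, h2.neg_one_pow]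

theorem cyc_rec (m k : ℕ) : cyc (m + 1) (k + 3) = (k + 2) * cyc m (k + 3) + cyc m (k + 2) := by
  simp [cyc]

theorem cyc_gt (m k : ℕ) (h : m + 2 < k) : cyc m k = 0 := by
  induction m generalizing k with
  | zero => simp [cyc]; omega
  | succ m ih =>
    obtain ⟨j, rfl⟩ : ∃ j, k = j + 3 := ⟨k - 3, by omega⟩
    rw [cyc_rec, ih _ (by omega), ih _ (by omega)]; simp

theorem cyc_pos (m k : ℕ) (h1 : 3 ≤ k) (h2 : k ≤ m + 3) : 0 < cyc (m + 1) k := by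
  induction m generalizing k with
  | zero =>
    obtain rfl : k = 3 := by omega
    simp [cyc]
  | succ m ih =>
    obtain ⟨j, rfl⟩ : ∃ j, k = j + 3 := ⟨k - 3, by omega⟩
    rw [cyc_rec]
    rcases j with _ | j
    · have := ih 3 (by omega) (by omega)
      have h3 := cyc_two (m + 1)
      have h4 : 0 ≤ cyc (m + 1) 2 := by rw [h3]; split_ifs <;> simp
      simp only [zero_add]
      push_cast
      linarith
    · have ha := ih (j + 1 + 2) (by omega) (by omega)
      rcases Nat.lt_or_ge (m + 3) (j + 1 + 3) with h | h
      · rw [cyc_gt _ _ (by omega)]; simpa using ha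
      · have hb := ih (j + 1 + 3) (by omega) (by omega)
        positivity

theorem cyc_nonneg (m k : ℕ) : 0 ≤ cyc m k := by
  rcases m with _ | m
  · simp only [cyc]; split_ifs <;> simp
  · rcases Nat.lt_or_ge (m + 3) k with h | h
    · rw [cyc_gt _ _ (by omega)]
    · by_cases h3 : 3 ≤ k
      · exact (cyc_pos m k h3 h).le
      · interval_cases k
        · rw [cyc_zero]
        · rw [cyc_one]
        · rw [cyc_two]; split_ifs <;> simp

theorem desc_succ_int (x k : ℕ) : ((x.descFactorial (k + 1) : ℕ) : ℤ) =
    ((x : ℤ) - k) * (x.descFactorial k : ℤ) := by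
  rw [Nat.descFactorial_succ]
  rcases Nat.lt_or_ge x k with h | h
  · rw [Nat.descFactorial_of_lt h]; simp
  · push_cast [h]; ring

theorem cyc_sum (m x N : ℕ) (hN : m + 2 < N) :
    ∑ k ∈ Finset.range N, cyc m k * (x.descFactorial k : ℤ) =
    ((x : ℤ) - 1) ^ (m + 2) + (-1) ^ (m + 2) * ((x : ℤ) - 1) := by
  induction m generalizing N with
  | zero =>
    rw [Finset.sum_eq_single 2]
    · simp only [cyc, desc_succ_int]; simp; ring
    · intro b _ hb; simp [cyc, hb]
    · simp; omega
  | succ m ih =>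
    obtain ⟨N, rfl⟩ : ∃ M, N = M + 1 := ⟨N - 1, by omega⟩
    have hN' : m + 2 < N := by omega
    have h0 := ih N hN'
    have h1 := ih (N + 1) (by omega)
    rw [Finset.sum_range_succ'] at h1 ⊢
    simp only [cyc_zero, zero_mul, add_zero] at h1 ⊢
    have e1 : ∑ k ∈ Finset.range N, (if k = 1 then (-1 : ℤ) ^ (m + 1) else 0) * (x.descFactorial (k + 1) : ℤ)
        = (-1) ^ (m + 1) * (x * (x - 1)) := by
      rw [Finset.sum_eq_single 1]
      · rw [desc_succ_int, desc_succ_int]; simp; ring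
      · intro b _ hb; simp [hb]
      · simp; omega
    have e2 : ∀ k ∈ Finset.range N, cyc (m + 1) (k + 1) * (x.descFactorial (k + 1) : ℤ) =
        k * (cyc m (k + 1) * (x.descFactorial (k + 1) : ℤ)) +
          (x - k) * (cyc m k * (x.descFactorial k : ℤ)) +
        (if k = 1 then (-1 : ℤ) ^ (m + 1) else 0) * (x.descFactorial (k + 1) : ℤ) := by
      intro k _
      rw [cyc, add_mul, add_mul, desc_succ_int x k]; ring
    rw [Finset.sum_congr rfl e2, Finset.sum_add_distrib, Finset.sum_add_distrib, e1]
    have e3 : ∑ k ∈ Finset.range N, (k : ℤ) * (cyc m (k + 1) * (x.descFactorial (k + 1) : ℤ)) =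
        ∑ k ∈ Finset.range N, ((k : ℤ) - 1) * (cyc m k * (x.descFactorial k : ℤ)) := by
      have := Finset.sum_range_succ' (fun k : ℕ => ((k : ℤ) - 1) * (cyc m k * (x.descFactorial k : ℤ))) N
      rw [Finset.sum_range_succ, cyc_zero, cyc_gt m N hN'] at this
      simp only [zero_mul, mul_zero, add_zero] at this
      rw [this]
      apply Finset.sum_congr rfl
      intro k _
      push_cast; ring
    rw [e3, ← Finset.sum_add_distrib]
    have e4 : ∑ k ∈ Finset.range N, (((k : ℤ) - 1) * (cyc m k * (x.descFactorial k : ℤ)) +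
        (x - k) * (cyc m k * (x.descFactorial k : ℤ))) =
        (x - 1) * ∑ k ∈ Finset.range N, cyc m k * (x.descFactorial k : ℤ) := by
      rw [Finset.mul_sum]
      apply Finset.sum_congr rfl
      intro k _
      ring
    rw [e4, h0]
    ring

theorem stir_eq_cyc (m k : ℕ) : (graphStirling (cycleGraph (m + 2)) k : ℤ) = cyc m k := by
  have := desc_unique (m + 3 + k)
    (fun k => (graphStirling (cycleGraph (m + 2)) k : ℤ) - cyc m k) (by
      intro x
      simp only [sub_mul]
      rw [Finset.sum_sub_distrib, cyc_sum m x _ (by omega), ← chrom_cycle m x,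
        chromaticCount_eq _ x (m + 3 + k) (by simp; omega)]
      push_cast
      simp) k (by omega)
  simpa [sub_eq_zero] using this

theorem alg_step (k t p q r s : ℤ) (hk : 2 ≤ k) (ht : 0 ≤ t) (hq : 0 < q) (hr : 0 < r)
    (hp : 0 ≤ p)
    (h1 : (k + 1) * (t + 1) * (q * s) ≤ k * t * r ^ 2)
    (h2 : k * (t + 2) * (p * r) ≤ (k - 1) * (t + 1) * q ^ 2) :
    (k + 1) * (t + 2) * (((k - 2) * q + p) * (k * s + r)) < k * (t + 1) * ((k - 1) * r + q) ^ 2 := by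
  have hk0 : 0 < k := by linarith
  have hk2 : 0 ≤ k - 2 := by linarith
  have hc : 0 < k * (t + 1) * (q * r) := by positivity
  have h3 : (k + 1) * (t + 2) * (p * s) ≤ (k - 1) * t * (q * r) := by
    have h := mul_le_mul h1 h2 (by positivity) (by positivity)
    refine le_of_mul_le_mul_left ?_ hc
    linarith
  have f1 := mul_nonneg (by positivity : 0 ≤ k ^ 2 * (k - 2) * (t + 2)) (sub_nonneg.2 h1)
  have f2 := mul_nonneg (by positivity : 0 ≤ (k + 1) * (t + 1)) (sub_nonneg.2 h2)
  have f3 := mul_nonneg (by positivity : 0 ≤ k ^ 2 * (t + 1)) (sub_nonneg.2 h3)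
  have f4 : 0 < k ^ 2 * ((k - 1) ^ 2 + t ^ 2 + 2 * t) * r ^ 2 + 2 * k * (t + 1) * (t + 2) * (q * r)
    + (t + 1) ^ 2 * q ^ 2 := by positivity
  have hd : 0 < k * (t + 1) := by positivity
  refine lt_of_mul_lt_mul_left ?_ hd.le
  linarith

theorem three_aux (m : ℕ) : 3 ≤ cyc (m + 3) 3 ∧ 8 * cyc (m + 3) 4 < 3 * cyc (m + 3) 3 ^ 2 := by
  induction m with
  | zero => simp [cyc]
  | succ m ih =>
    have h3 : cyc (m + 1 + 3) 3 = 2 * cyc (m + 3) 3 + cyc (m + 3) 2 := by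
      have := cyc_rec (m + 3) 0; simpa using this
    have h4 : cyc (m + 1 + 3) 4 = 3 * cyc (m + 3) 4 + cyc (m + 3) 3 := by
      have := cyc_rec (m + 3) 1; norm_num at this; exact this
    have h2 := cyc_nonneg (m + 3) 2
    rw [h3, h4]
    constructor
    · linarith
    · nlinarith

theorem main_ineq (m j t : ℕ) (h : m = j + t + 2) :
    ((j : ℤ) + 4) * (t + 2) * (cyc m (j + 2) * cyc m (j + 4)) <
      (j + 3) * (t + 1) * cyc m (j + 3) ^ 2 := by
  induction m generalizing j t with
  | zero => omega
  | succ m ih =>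
    rcases j with _ | j
    · have h3 := cyc_pos m 3 (by omega) (by omega)
      have h4 := cyc_nonneg (m + 1) 4
      have h2 := cyc_two (m + 1)
      have ha : 8 * (cyc (m + 1) 2 * cyc (m + 1) 4) < 3 * cyc (m + 1) 3 ^ 2 := by
        have h8 : 8 * cyc (m + 1) 4 < 3 * cyc (m + 1) 3 ^ 2 := by
          rcases t with _ | t
          · obtain rfl : m = 1 := by omega
            simp [cyc]
          · obtain rfl : m = t + 2 := by omega
            have := (three_aux t).2
            have e : t + 2 + 1 = t + 3 := rfl
            rw [e] at h4 ⊢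
            linarith
        rw [h2]
        split_ifs
        · linarith
        · simp; positivity
      simp only [zero_add]
      push_cast
      have hn := mul_nonneg (cyc_nonneg (m + 1) 2) h4
      have ht : (0 : ℤ) ≤ t := by positivity
      nlinarith [mul_nonneg ht hn, mul_nonneg ht (sub_nonneg.2 ha.le)]
    · obtain ⟨m, rfl⟩ : ∃ m', m = m' + 1 := ⟨m - 1, by omega⟩
      have hq := cyc_pos m (j + 3) (by omega) (by omega)
      have hr := cyc_pos m (j + 4) (by omega) (by omega)
      have key := alg_step (j + 4) t (cyc (m + 1) (j + 2)) (cyc (m + 1) (j + 3))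
        (cyc (m + 1) (j + 4)) (cyc (m + 1) (j + 5)) (by omega) (by omega) hq hr
        (cyc_nonneg _ _) (by
          rcases t with _ | t
          · rw [cyc_gt (m + 1) (j + 5) (by omega)]; simp
          · have := ih (j + 1) t (by omega)
            push_cast at this ⊢
            ring_nf at this ⊢
            linarith) (by
          have := ih j t (by omega)
          push_cast at this ⊢
          ring_nf at this ⊢
          linarith)
      have e1 := cyc_rec (m + 1) j
      have e2 := cyc_rec (m + 1) (j + 1)
      have e3 := cyc_rec (m + 1) (j + 2)
      have r1 : j + 1 + 2 = j + 3 := rfl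
      have r2 : j + 1 + 3 = j + 4 := rfl
      have r3 : j + 1 + 4 = j + 5 := rfl
      have r4 : j + 2 + 3 = j + 5 := rfl
      have r5 : j + 2 + 2 = j + 4 := rfl
      rw [r2, r1] at e2
      rw [r4, r5] at e3
      rw [r1, r2, r3, e1, e2, e3]
      push_cast
      ring_nf at key ⊢
      linarith

theorem choose_conv (m k : ℕ) (a b c : ℚ) (hk1 : 1 ≤ k) (hk : k ≤ m) :
    (a / ((m + 1).choose (k - 1) : ℚ)) * (c / ((m + 1).choose (k + 1) : ℚ)) <
      (b / ((m + 1).choose k : ℚ)) ^ 2 ↔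
    (k + 1) * (m + 2 - k) * (a * c) < k * (m + 1 - k) * b ^ 2 := by
  obtain ⟨k, rfl⟩ : ∃ k', k = k' + 1 := ⟨k - 1, by omega⟩
  rw [Nat.add_sub_cancel]
  have h0 : (0 : ℚ) < ((m + 1).choose k : ℚ) := by exact_mod_cast Nat.choose_pos (by omega)
  have h1 : (0 : ℚ) < ((m + 1).choose (k + 1) : ℚ) := by exact_mod_cast Nat.choose_pos (by omega)
  have h2 : (0 : ℚ) < ((m + 1).choose (k + 1 + 1) : ℚ) := by exact_mod_cast Nat.choose_pos (by omega)
  have e0 := Nat.choose_succ_right_eq (m + 1) k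
  have e1 := Nat.choose_succ_right_eq (m + 1) (k + 1)
  have e0' : ((m + 1).choose (k + 1) : ℚ) * (k + 1) = (m + 1).choose k * (m + 1 - k) := by
    have : (((m + 1 - k : ℕ)) : ℚ) = m + 1 - k := by push_cast [show k ≤ m + 1 by omega]; ring
    rw [← this]; exact_mod_cast e0
  have e1' : ((m + 1).choose (k + 1 + 1) : ℚ) * (k + 2) = (m + 1).choose (k + 1) * (m - k) := by
    have : (((m + 1 - (k + 1) : ℕ)) : ℚ) = m - k := by rw [Nat.cast_sub (by omega)]; push_cast; ring
    rw [← this]; exact_mod_cast e1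
  set x := ((m + 1).choose k : ℚ)
  set y := ((m + 1).choose (k + 1) : ℚ)
  set z := ((m + 1).choose (k + 1 + 1) : ℚ)
  have hkm : (k : ℚ) + 1 ≤ m := by exact_mod_cast hk
  have hA : (0 : ℚ) < m + 1 - k := by linarith
  have hB : (0 : ℚ) < m - k := by linarith
  have hx : x = y * (k + 1) / (m + 1 - k) := by field_simp; linarith
  have hz : z = y * (m - k) / (k + 2) := by field_simp; linarith
  have : (b / y) ^ 2 - (a / x) * (c / z) =
      ((k + 1) * (m - k) * b ^ 2 - (k + 2) * (m + 1 - k) * (a * c)) / (y ^ 2 * ((k + 1) * (m - k))) := by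
    rw [hx, hz]
    field_simp
  rw [← sub_pos, this, div_pos_iff_of_pos_right (by positivity), sub_pos]
  push_cast
  have g1 : ((k : ℚ) + 1 + 1) * (m + 2 - (k + 1)) = (k + 2) * (m + 1 - k) := by ring
  have g2 : ((k : ℚ) + 1) * (m + 1 - (k + 1)) = (k + 1) * (m - k) := by ring
  rw [g1, g2]

theorem cycle_graphStirling_ultra_log_concave (n : ℕ) (hn : 3 ≤ n)
    (k : ℕ) (hk1 : 1 ≤ k) (hk2 : k ≤ n - 1) :
    ((graphStirling (SimpleGraph.cycleGraph n) k : ℚ) / (Nat.choose n k : ℚ)) ^ 2 ≥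
      ((graphStirling (SimpleGraph.cycleGraph n) (k - 1) : ℚ) / (Nat.choose n (k - 1) : ℚ)) *
        ((graphStirling (SimpleGraph.cycleGraph n) (k + 1) : ℚ) / (Nat.choose n (k + 1) : ℚ))
    ∧ ((SimpleGraph.cycleGraph n).chromaticNumber ≤ (k : ℕ∞) →
      ((graphStirling (SimpleGraph.cycleGraph n) k : ℚ) / (Nat.choose n k : ℚ)) ^ 2 >
        ((graphStirling (SimpleGraph.cycleGraph n) (k - 1) : ℚ) / (Nat.choose n (k - 1) : ℚ)) *
          ((graphStirling (SimpleGraph.cycleGraph n) (k + 1) : ℚ) / (Nat.choose n (k + 1) : ℚ))) := by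
  obtain ⟨m, rfl⟩ : ∃ m, n = m + 2 := ⟨n - 2, by omega⟩
  have hS : ∀ k, (graphStirling (SimpleGraph.cycleGraph (m + 2)) k : ℚ) = (cyc m k : ℚ) := by
    intro k
    rw [← stir_eq_cyc]; simp
  simp only [hS]
  by_cases hk3 : 3 ≤ k
  · obtain ⟨j, rfl⟩ : ∃ j, k = j + 3 := ⟨k - 3, by omega⟩
    obtain ⟨t, ht⟩ : ∃ t, m = j + t + 2 := ⟨m - j - 2, by omega⟩
    have := main_ineq m j t ht
    have h := (choose_conv (m + 1) (j + 3) (cyc m (j + 2)) (cyc m (j + 3)) (cyc m (j + 4))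
      (by omega) (by omega)).2 (by
        have h' : (((j : ℤ) + 4) * (t + 2) * (cyc m (j + 2) * cyc m (j + 4)) : ℚ) <
          (j + 3) * (t + 1) * cyc m (j + 3) ^ 2 := by exact_mod_cast this
        have hm : (m : ℚ) = j + t + 2 := by exact_mod_cast ht
        push_cast at h' ⊢
        rw [hm]
        ring_nf at h' ⊢
        linarith)
    exact ⟨h.le, fun _ => h⟩
  · have hz : cyc m (k - 1) = 0 := by
      have : k = 1 ∨ k = 2 := by omega
      rcases this with rfl | rfl
      · exact cyc_zero m
      · exact cyc_one m
    rw [hz]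
    simp only [Int.cast_zero, zero_div, zero_mul]
    refine ⟨by positivity, fun hχ => ?_⟩
    rcases Nat.even_or_odd (m + 2) with he | ho
    · rw [chromaticNumber_cycleGraph_of_even _ (by omega) he] at hχ
      have h2 : 2 ≤ k := by exact_mod_cast hχ
      obtain rfl : k = 2 := by omega
      have hm : Even m := by simpa [Nat.even_add] using he
      rw [cyc_two, if_pos hm]
      have h0 : (0 : ℚ) < ((m + 2).choose 2 : ℚ) := by exact_mod_cast Nat.choose_pos (by omega)
      positivity
    · rw [chromaticNumber_cycleGraph_of_odd _ (by omega) ho] at hχ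
      have h2 : 3 ≤ k := by exact_mod_cast hχ
      omega
end
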